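/- arXiv:2502.08632 — 2 statements merged into one kernel-verified Lean document; each statement's English description precedes it below -/
import Mathlib

section
/- Let M be a finite-horizon latent MDP with state space S. Then for every h ∈ {1,…,H}, every s ∈ S, every finite set Γ ⊂ Π, and every policy π: d^{M̄(∅),π}_h(s) ≤ d^{M̄(Γ),π}_h(s) ≤ d^{M,π}_h(s), where M̄(Γ) and M̄(∅) are the truncated MDPs defined in the context. -/
open scoped Classical

section MDPDefs

/- Throughout, internal step index `k : ℕ` corresponds to step `k + 1` of the informal
statement (so an informal step `h ∈ {1,…,H}` is the internal index `h - 1`).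
`P1` is the initial latent-state distribution and `P k s a s'` is the transition
probability from state `s` at internal step `k` to state `s'` at internal step `k+1`
(i.e. the transition kernel `P_{k+2}` of the informal statement). -/

variable {S A : Type*}

/-- `π` is a valid (time-inhomogeneous, possibly randomized) policy:
at every internal step `k` and state `s`, `π k s` is a distribution on actions. -/
def IsPolicy [Fintype A] (π : ℕ → S → A → ℝ) : Prop :=
  ∀ k s, (∀ a, 0 ≤ π k s a) ∧ ∑ a, π k s a = 1

/-- Visitation probabilities in the (untruncated) latent MDP `M = (P1, P)`:
`visit P1 P π k s` is `d^{M,π}_{k+1}(s)` of the informal statement. -/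
noncomputable def visit [Fintype S] [Fintype A] (P1 : S → ℝ)
    (P : ℕ → S → A → S → ℝ) (π : ℕ → S → A → ℝ) : ℕ → S → ℝ
  | 0, s => P1 s
  | k + 1, s' => ∑ s, ∑ a, visit P1 P π k s * π k s a * P k s a s'

/-- Visitation probabilities in the `T`-truncated MDP: the state space is `Option S`,
with `none` playing the role of the absorbing terminal state `⊥`, and `T k` is the
truncation set used for the transition into internal step `k` (i.e. the set `T_{k+1}`
of the informal statement). -/
noncomputable def truncVisit [Fintype S] [Fintype A] (P1 : S → ℝ)
    (P : ℕ → S → A → S → ℝ) (T : ℕ → Set S) (π : ℕ → S → A → ℝ) :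
    ℕ → Option S → ℝ
  | 0, some s => if s ∈ T 0 then P1 s else 0
  | 0, none => ∑ s ∈ Finset.univ.filter (fun s => s ∉ T 0), P1 s
  | k + 1, some s' =>
      if s' ∈ T (k + 1) then
        ∑ s, ∑ a, truncVisit P1 P T π k (some s) * π k s a * P k s a s'
      else 0
  | k + 1, none =>
      truncVisit P1 P T π k none +
        ∑ s, ∑ a, truncVisit P1 P T π k (some s) * π k s a *
          ∑ s' ∈ Finset.univ.filter (fun s' => s' ∉ T (k + 1)), P k s a s'

/-- Supremum over all valid policies. -/
noncomputable def polSup [Fintype A] (f : (ℕ → S → A → ℝ) → ℝ) : ℝ :=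
  sSup (f '' {π | IsPolicy π})

/-- `prefixSets P1 P σ k` is the family of truncation sets of the truncated MDP
`M̄_{k+1}(∅)` of the informal statement: it equals `S_{j+1}(∅)` for `j ≤ k` and the
whole state space for `j > k`. -/
noncomputable def prefixSets [Fintype S] [Fintype A] (P1 : S → ℝ)
    (P : ℕ → S → A → S → ℝ) (σ : ℝ) : ℕ → ℕ → Set S
  | 0 => fun j => if j = 0 then {s | σ ≤ P1 s} else Set.univ
  | k + 1 => fun j =>
      if j ≤ k then prefixSets P1 P σ k j
      else if j = k + 1 then
        {s | σ ≤ polSup fun π =>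
          truncVisit P1 P (prefixSets P1 P σ k) π (k + 1) (some s)}
      else Set.univ

/-- `SRchEmpty P1 P σ k` is the set `S_{k+1}(∅)` of the informal statement; the family
`SRchEmpty P1 P σ` is the family of truncation sets of `M̄(∅)`. -/
noncomputable def SRchEmpty [Fintype S] [Fintype A] (P1 : S → ℝ)
    (P : ℕ → S → A → S → ℝ) (σ : ℝ) (k : ℕ) : Set S :=
  prefixSets P1 P σ k k

/-- `SRchGam P1 P σ σ' Γ k` is the set `S_{k+1}(Γ)` of the informal statement (for
`Γ = ∅` it coincides with `SRchEmpty`, since then the second set below is empty);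
the family `SRchGam P1 P σ σ' Γ` is the family of truncation sets of `M̄(Γ)`. -/
noncomputable def SRchGam [Fintype S] [Fintype A] (P1 : S → ℝ)
    (P : ℕ → S → A → S → ℝ) (σ σ' : ℝ) (Γ : Finset (ℕ → S → A → ℝ)) (k : ℕ) :
    Set S :=
  SRchEmpty P1 P σ k ∪
    {s | σ' ≤ (Γ.card : ℝ)⁻¹ * ∑ π ∈ Γ, visit P1 P π k s}

end MDPDefs

section Truncation

variable {S A : Type*} [Fintype S] [Fintype A] {P1 : S → ℝ} {P : ℕ → S → A → S → ℝ}
  {π : ℕ → S → A → ℝ}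

theorem truncVisit_some_nonneg (hP1 : ∀ s, 0 ≤ P1 s) (hP : ∀ k s a s', 0 ≤ P k s a s')
    (hπ : ∀ k s a, 0 ≤ π k s a) (T : ℕ → Set S) (k : ℕ) (s : S) :
    0 ≤ truncVisit P1 P T π k (some s) := by
  induction k generalizing s with
  | zero =>
    simp only [truncVisit]
    split_ifs
    exacts [hP1 s, le_rfl]
  | succ k ih =>
    simp only [truncVisit]
    split_ifs
    · exact Finset.sum_nonneg fun x _ => Finset.sum_nonneg fun a _ =>
        mul_nonneg (mul_nonneg (ih x) (hπ k x a)) (hP k x a s)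
    · exact le_rfl

/-- Enlarging the truncation sets increases the visitation probabilities of latent states. -/
theorem truncVisit_some_mono (hP1 : ∀ s, 0 ≤ P1 s) (hP : ∀ k s a s', 0 ≤ P k s a s')
    (hπ : ∀ k s a, 0 ≤ π k s a) {T T' : ℕ → Set S} (hT : ∀ k, T k ⊆ T' k) (k : ℕ) (s : S) :
    truncVisit P1 P T π k (some s) ≤ truncVisit P1 P T' π k (some s) := by
  induction k generalizing s with
  | zero =>
    by_cases hs : s ∈ T 0
    · simp [truncVisit, hs, hT 0 hs]
    · simpa [truncVisit, hs] using truncVisit_some_nonneg hP1 hP hπ T' 0 s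
  | succ k ih =>
    by_cases hs : s ∈ T (k + 1)
    · simp only [truncVisit, hs, hT (k + 1) hs, if_true]
      exact Finset.sum_le_sum fun x _ => Finset.sum_le_sum fun a _ =>
        mul_le_mul_of_nonneg_right (mul_le_mul_of_nonneg_right (ih x) (hπ k x a)) (hP k x a s)
    · simpa [truncVisit, hs] using truncVisit_some_nonneg hP1 hP hπ T' (k + 1) s

theorem truncVisit_univ_some (k : ℕ) (s : S) :
    truncVisit P1 P (fun _ => Set.univ) π k (some s) = visit P1 P π k s := by
  induction k generalizing s with
  | zero => simp [truncVisit, visit]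
  | succ k ih => simp [truncVisit, visit, ih]

theorem truncVisit_some_le_visit (hP1 : ∀ s, 0 ≤ P1 s) (hP : ∀ k s a s', 0 ≤ P k s a s')
    (hπ : ∀ k s a, 0 ≤ π k s a) (T : ℕ → Set S) (k : ℕ) (s : S) :
    truncVisit P1 P T π k (some s) ≤ visit P1 P π k s :=
  (truncVisit_some_mono hP1 hP hπ (fun _ => Set.subset_univ _) k s).trans_eq
    (truncVisit_univ_some k s)

end Truncation

/-- For every `h ∈ {1,…,H}`, every state `s`, every finite set of
policies `Γ`, and every policy `π`:
`d^{M̄(∅),π}_h(s) ≤ d^{M̄(Γ),π}_h(s) ≤ d^{M,π}_h(s)`.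
(Informal step `h` is internal index `h - 1`.) -/
theorem stmt7 {S A : Type*} [Fintype S] [Fintype A] [Nonempty S] [Nonempty A]
    (P1 : S → ℝ) (hP1 : (∀ s, 0 ≤ P1 s) ∧ ∑ s, P1 s = 1)
    (P : ℕ → S → A → S → ℝ)
    (hP : ∀ k s a, (∀ s', 0 ≤ P k s a s') ∧ ∑ s', P k s a s' = 1)
    (H : ℕ) (hH : 1 ≤ H) (σ σ' : ℝ) (hσ' : 0 < σ') (hσ : σ' ≤ σ)
    (Γ : Finset (ℕ → S → A → ℝ)) (hΓ : ∀ π ∈ Γ, IsPolicy π)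
    (h : ℕ) (hh1 : 1 ≤ h) (hh2 : h ≤ H) (s : S)
    (π : ℕ → S → A → ℝ) (hπ : IsPolicy π) :
    truncVisit P1 P (SRchEmpty P1 P σ) π (h - 1) (some s) ≤
        truncVisit P1 P (SRchGam P1 P σ σ' Γ) π (h - 1) (some s) ∧
      truncVisit P1 P (SRchGam P1 P σ σ' Γ) π (h - 1) (some s) ≤
        visit P1 P π (h - 1) s := by
  have hP' : ∀ k s a s', 0 ≤ P k s a s' := fun k s a => (hP k s a).1
  have hπ' : ∀ k s a, 0 ≤ π k s a := fun k s => (hπ k s).1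
  exact ⟨truncVisit_some_mono hP1.1 hP' hπ' (fun _ => Set.subset_union_left) _ s,
    truncVisit_some_le_visit hP1.1 hP' hπ' _ _ s⟩
end

section
/- Let M be a finite-horizon latent MDP with state space S and let M̄(∅) be the truncated MDP of the context with parameter σ. Then for every policy π ∈ Π, every h ∈ {1,…,H}, and every s ∈ S: d^{M̄(∅),π}_h(s) ≥ d^{M,π}_h(s) − h·|S|·σ. -/
open scoped Classical

section TruncationLemmas

variable {S A : Type*} [Fintype S] [Fintype A] {P1 : S → ℝ} {P : ℕ → S → A → S → ℝ}

theorem visit_nonneg (hP1 : ∀ s, 0 ≤ P1 s) (hP : ∀ k s a s', 0 ≤ P k s a s')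
    {π : ℕ → S → A → ℝ} (hπ : IsPolicy π) (k : ℕ) (s : S) : 0 ≤ visit P1 P π k s := by
  induction k generalizing s with
  | zero => exact hP1 s
  | succ k ih =>
    exact Finset.sum_nonneg fun z _ => Finset.sum_nonneg fun a _ =>
      mul_nonneg (mul_nonneg (ih z) ((hπ k z).1 a)) (hP k z a s)

/-- Pushing a weight on states through one step of the chain preserves its total mass. -/
theorem sum_step_eq_sum (hP : ∀ k s a, ∑ s', P k s a s' = 1)
    {π : ℕ → S → A → ℝ} (hπ : IsPolicy π) (k : ℕ) (f : S → ℝ) :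
    ∑ s', ∑ s, ∑ a, f s * π k s a * P k s a s' = ∑ s, f s := by
  rw [Finset.sum_comm]
  refine Finset.sum_congr rfl fun s _ => ?_
  rw [Finset.sum_comm]
  simp_rw [← Finset.mul_sum, hP, mul_one]
  rw [← Finset.mul_sum, (hπ k s).2, mul_one]

theorem sum_visit (hP1 : ∑ s, P1 s = 1) (hP : ∀ k s a, ∑ s', P k s a s' = 1)
    {π : ℕ → S → A → ℝ} (hπ : IsPolicy π) (k : ℕ) : ∑ s, visit P1 P π k s = 1 := by
  induction k with
  | zero => exact hP1
  | succ k ih => exact (sum_step_eq_sum hP hπ k _).trans ih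

theorem truncVisit_le_visit (hP1 : ∀ s, 0 ≤ P1 s) (hP : ∀ k s a s', 0 ≤ P k s a s')
    (T : ℕ → Set S) {π : ℕ → S → A → ℝ} (hπ : IsPolicy π) (k : ℕ) (s : S) :
    truncVisit P1 P T π k (some s) ≤ visit P1 P π k s := by
  induction k generalizing s with
  | zero =>
    rw [truncVisit, visit]
    split_ifs
    exacts [le_rfl, hP1 s]
  | succ k ih =>
    rw [truncVisit]
    split_ifs
    · exact Finset.sum_le_sum fun z _ => Finset.sum_le_sum fun a _ =>
        mul_le_mul_of_nonneg_right
          (mul_le_mul_of_nonneg_right (ih z) ((hπ k z).1 a)) (hP k z a s)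
    · exact visit_nonneg hP1 hP hπ (k + 1) s

theorem truncVisit_congr {T T' : ℕ → Set S} (π : ℕ → S → A → ℝ) {k : ℕ}
    (hT : ∀ j ≤ k, T j = T' j) (s : S) :
    truncVisit P1 P T π k (some s) = truncVisit P1 P T' π k (some s) := by
  induction k generalizing s with
  | zero => rw [truncVisit, truncVisit, hT 0 le_rfl]
  | succ k ih =>
    rw [truncVisit, truncVisit, hT (k + 1) le_rfl]
    simp_rw [ih fun j hj => hT j (hj.trans k.le_succ)]

/-- If truncation removes at most mass `σ` at each state and step, the total mass lost
after `k + 1` truncations is at most `(k + 1) * |S| * σ`. -/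
theorem sum_visit_sub_truncVisit_le (hP : ∀ k s a, ∑ s', P k s a s' = 1)
    {T : ℕ → Set S} {σ : ℝ} (hσ : 0 ≤ σ) {π : ℕ → S → A → ℝ} (hπ : IsPolicy π)
    (h_start : ∀ s ∉ T 0, P1 s ≤ σ)
    (h_step : ∀ k, ∀ s' ∉ T (k + 1),
      ∑ s, ∑ a, truncVisit P1 P T π k (some s) * π k s a * P k s a s' ≤ σ) (k : ℕ) :
    ∑ s, (visit P1 P π k s - truncVisit P1 P T π k (some s)) ≤
      (k + 1 : ℝ) * Fintype.card S * σ := by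
  induction k with
  | zero =>
    calc ∑ s, (visit P1 P π 0 s - truncVisit P1 P T π 0 (some s))
        ≤ ∑ _s : S, σ := by
          refine Finset.sum_le_sum fun s _ => ?_
          rw [visit, truncVisit]
          split_ifs with hs
          · simpa using hσ
          · simpa using h_start s hs
      _ = _ := by simp
  | succ k ih =>
    calc ∑ s', (visit P1 P π (k + 1) s' - truncVisit P1 P T π (k + 1) (some s'))
        ≤ ∑ s', (∑ s, ∑ a, (visit P1 P π k s - truncVisit P1 P T π k (some s)) *
            π k s a * P k s a s' + σ) := by
          refine Finset.sum_le_sum fun s' _ => ?_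
          rw [visit, truncVisit]
          simp_rw [sub_mul, Finset.sum_sub_distrib]
          split_ifs with hs
          · linarith
          · linarith [h_step k s' hs]
      _ = ∑ s, (visit P1 P π k s - truncVisit P1 P T π k (some s)) +
            Fintype.card S * σ := by
          rw [Finset.sum_add_distrib, sum_step_eq_sum hP hπ]
          simp
      _ ≤ _ := by
          push_cast
          linarith

theorem prefixSets_of_lt (σ : ℝ) {k j : ℕ} (h : k < j) :
    prefixSets P1 P σ k j = Set.univ := by
  cases k with
  | zero => simp [prefixSets, h.ne']
  | succ k => simp [prefixSets, h.ne', show ¬ j ≤ k by omega]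

theorem prefixSets_of_le (σ : ℝ) {k j : ℕ} (h : j ≤ k) :
    prefixSets P1 P σ k j = SRchEmpty P1 P σ j := by
  induction k, h using Nat.le_induction with
  | base => rfl
  | succ k h ih => simp [prefixSets, h, ih]

/-- The mass flowing in one step into a state outside `SRchEmpty` is less than `σ`. -/
theorem step_lt_of_notMem_SRchEmpty
    (hP1 : (∀ s, 0 ≤ P1 s) ∧ ∑ s, P1 s = 1)
    (hP : ∀ k s a, (∀ s', 0 ≤ P k s a s') ∧ ∑ s', P k s a s' = 1) {σ : ℝ}
    {π : ℕ → S → A → ℝ} (hπ : IsPolicy π) {k : ℕ} {s' : S}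
    (hs : s' ∉ SRchEmpty P1 P σ (k + 1)) :
    ∑ s, ∑ a, truncVisit P1 P (SRchEmpty P1 P σ) π k (some s) * π k s a * P k s a s' < σ := by
  have h_sup : polSup (fun ρ : ℕ → S → A → ℝ =>
      truncVisit P1 P (prefixSets P1 P σ k) ρ (k + 1) (some s')) < σ := by
    simpa [SRchEmpty, prefixSets] using hs
  have h_bdd : BddAbove ((fun ρ : ℕ → S → A → ℝ =>
      truncVisit P1 P (prefixSets P1 P σ k) ρ (k + 1) (some s')) '' {ρ | IsPolicy ρ}) := by
    refine ⟨1, ?_⟩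
    rintro _ ⟨ρ, hρ, rfl⟩
    have h_nonneg := visit_nonneg hP1.1 (fun k s a => (hP k s a).1) hρ (k + 1)
    calc truncVisit P1 P (prefixSets P1 P σ k) ρ (k + 1) (some s')
        ≤ visit P1 P ρ (k + 1) s' :=
          truncVisit_le_visit hP1.1 (fun k s a => (hP k s a).1) _ hρ _ _
      _ ≤ ∑ s, visit P1 P ρ (k + 1) s :=
          Finset.single_le_sum (fun s _ => h_nonneg s) (Finset.mem_univ s')
      _ = 1 := sum_visit hP1.2 (fun k s a => (hP k s a).2) hρ _
  refine lt_of_eq_of_lt ?_ ((le_csSup h_bdd ⟨π, hπ, rfl⟩).trans_lt h_sup)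
  simp only [truncVisit, prefixSets_of_lt σ k.lt_succ_self, Set.mem_univ, if_true]
  simp_rw [truncVisit_congr π fun j hj => prefixSets_of_le (P1 := P1) (P := P) σ hj]

end TruncationLemmas

/-- For every policy `π`, every `h ∈ {1,…,H}`, and every `s ∈ S`:
`d^{M̄(∅),π}_h(s) ≥ d^{M,π}_h(s) − h·|S|·σ`.
(Informal step `h` is internal index `h - 1`.) -/
theorem stmt10 {S A : Type*} [Fintype S] [Fintype A] [Nonempty S] [Nonempty A]
    (P1 : S → ℝ) (hP1 : (∀ s, 0 ≤ P1 s) ∧ ∑ s, P1 s = 1)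
    (P : ℕ → S → A → S → ℝ)
    (hP : ∀ k s a, (∀ s', 0 ≤ P k s a s') ∧ ∑ s', P k s a s' = 1)
    (H : ℕ) (hH : 1 ≤ H) (σ : ℝ) (hσ : 0 < σ)
    (π : ℕ → S → A → ℝ) (hπ : IsPolicy π)
    (h : ℕ) (hh1 : 1 ≤ h) (hh2 : h ≤ H) (s : S) :
    visit P1 P π (h - 1) s - (h : ℝ) * (Fintype.card S : ℝ) * σ ≤
      truncVisit P1 P (SRchEmpty P1 P σ) π (h - 1) (some s) := by
  obtain ⟨k, rfl⟩ := Nat.exists_eq_add_of_le' hh1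
  have h_sum := sum_visit_sub_truncVisit_le (fun k s a => (hP k s a).2) hσ.le hπ
    (fun s hs => le_of_lt (by simpa [SRchEmpty, prefixSets] using hs))
    (fun k s' hs => (step_lt_of_notMem_SRchEmpty hP1 hP hπ hs).le) k
  have h_single := Finset.single_le_sum
    (fun z _ => sub_nonneg.2 (truncVisit_le_visit hP1.1 (fun k s a => (hP k s a).1)
      (SRchEmpty P1 P σ) hπ k z)) (Finset.mem_univ s)
  rw [Nat.add_sub_cancel]
  push_cast
  linarith
end
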